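/- arXiv:1707.04726 — 4 statements merged into one kernel-verified Lean document; each statement's English description precedes it below -/
import Mathlib

section
/- Let w be a weight with M_w < ∞ and let T : ℓ¹ → ℓ¹ be the continuous linear operator satisfying (T x)(n) = (w(n)/n) ∑_{k=1}^n x(k)/w(k) for all x ∈ ℓ¹ and n ≥ 1. Let λ ∈ ℂ with λ ∉ Σ₀ := {0} ∪ {1/m : m ∈ ℕ, m ≥ 1}, and set α := Re(1/λ). Then λ belongs to the resolvent set of T (equivalently, λ ∉ σ(T)) if and only if sup_{m≥1} (1/(m^α · w(m))) ∑_{n=m+1}^∞ w(n)/n^{1−α} < ∞. -/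
/- STATEMENT 9: For λ ∉ Σ₀ and α = Re(1/λ): λ is in the resolvent set of T iff
sup_{m≥1} (1/(m^α w(m))) ∑_{n=m+1}^∞ w(n)/n^{1−α} < ∞.
Index `n : ℕ` corresponds to the paper's `n+1`. -/

open Filter Topology

noncomputable section

abbrev ellOne : Type := lp (fun _ : ℕ => ℂ) 1

def IsCesaroOp (v w : ℕ → ℝ) (T : ellOne →L[ℂ] ellOne) : Prop :=
  ∀ (x : ellOne) (n : ℕ),
    (T x : ∀ _ : ℕ, ℂ) n
      = ((w n / (n + 1) : ℝ) : ℂ) * ∑ k ∈ Finset.range (n + 1), (x : ∀ _ : ℕ, ℂ) k / ((v k : ℝ) : ℂ)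

def Mvw (v w : ℕ → ℝ) : ENNReal :=
  ⨆ n : ℕ, ENNReal.ofReal (1 / v n) * ∑' k : ℕ, ENNReal.ofReal (w (n + k) / (n + k + 1))

/-- The product `∏_{j=1}^n (1 - z / j)`. -/
def cesaroProd (z : ℂ) (n : ℕ) : ℂ := ∏ j ∈ Finset.range n, (1 - z / ((j : ℂ) + 1))

theorem cesaroProd_succ (z : ℂ) (n : ℕ) :
    cesaroProd z (n + 1) = cesaroProd z n * (1 - z / ((n : ℂ) + 1)) :=
  Finset.prod_range_succ _ _

theorem one_sub_div_ne_zero {z : ℂ} (hz : ∀ j : ℕ, z ≠ (j : ℂ) + 1) (n : ℕ) :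
    1 - z / ((n : ℂ) + 1) ≠ 0 := by
  rw [sub_ne_zero, ne_comm, Ne, div_eq_one_iff_eq (Nat.cast_add_one_ne_zero n)]
  exact hz n

theorem cesaroProd_ne_zero {z : ℂ} (hz : ∀ j : ℕ, z ≠ (j : ℂ) + 1) (n : ℕ) :
    cesaroProd z n ≠ 0 :=
  Finset.prod_ne_zero_iff.2 fun j _ => one_sub_div_ne_zero hz j

theorem exists_bounds_of_tendsto_pos {f : ℕ → ℝ} {L : ℝ} (hf : ∀ n, 0 < f n) (hL : 0 < L)
    (h : Tendsto f atTop (𝓝 L)) : ∃ c C : ℝ, 0 < c ∧ 0 < C ∧ ∀ n, c ≤ f n ∧ f n ≤ C := by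
  obtain ⟨C, hC⟩ := h.bddAbove_range
  obtain ⟨D, hD⟩ := (h.inv₀ hL.ne').bddAbove_range
  have hC' : ∀ n, f n ≤ C := fun n => hC ⟨n, rfl⟩
  have hD' : ∀ n, (f n)⁻¹ ≤ D := fun n => hD ⟨n, rfl⟩
  have hD0 : 0 < D := (inv_pos.2 (hf 0)).trans_le (hD' 0)
  exact ⟨D⁻¹, C, inv_pos.2 hD0, (hf 0).trans_le (hC' 0),
    fun n => ⟨inv_le_of_inv_le₀ (hf n) (hD' n), hC' n⟩⟩

theorem GammaSeq_neg_succ (z : ℂ) (n : ℕ) :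
    Complex.GammaSeq (-z) (n + 1) =
      ((n + 1 : ℕ) : ℂ) ^ (-z) / (-z * cesaroProd z (n + 1)) := by
  have h : ∏ j ∈ Finset.range (n + 1 + 1), (-z + (j : ℂ)) =
      -z * cesaroProd z (n + 1) * (Nat.factorial (n + 1) : ℂ) := by
    rw [Finset.prod_range_succ', ← Finset.prod_range_add_one_eq_factorial, cesaroProd,
      Nat.cast_prod, mul_assoc, ← Finset.prod_mul_distrib, mul_comm]
    congr 1
    · simp
    · refine Finset.prod_congr rfl fun j _ => ?_
      have h1 : (j : ℂ) + 1 ≠ 0 := Nat.cast_add_one_ne_zero j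
      push_cast
      field_simp
      ring
  have hf : (Nat.factorial (n + 1) : ℂ) ≠ 0 := Nat.cast_ne_zero.2 (Nat.factorial_ne_zero _)
  rw [Complex.GammaSeq, h, mul_div_mul_right _ _ hf]

theorem Gamma_neg_ne_zero {z : ℂ} (hz0 : z ≠ 0) (hz : ∀ j : ℕ, z ≠ (j : ℂ) + 1) :
    Complex.Gamma (-z) ≠ 0 := by
  refine Complex.Gamma_ne_zero fun m hm => ?_
  rw [neg_inj] at hm
  cases m with
  | zero => exact hz0 (by simpa using hm)
  | succ m => exact hz m (by simpa using hm)

theorem tendsto_norm_cesaroProd_succ_mul_rpow {z : ℂ} (hz0 : z ≠ 0)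
    (hz : ∀ j : ℕ, z ≠ (j : ℂ) + 1) :
    Tendsto (fun n : ℕ => ‖cesaroProd z (n + 1)‖ * ((n : ℝ) + 1) ^ z.re) atTop
      (𝓝 (‖z‖ * ‖Complex.Gamma (-z)‖)⁻¹) := by
  have hG := Gamma_neg_ne_zero hz0 hz
  have h := (((Complex.GammaSeq_tendsto_Gamma (-z)).comp (tendsto_add_atTop_nat 1)).norm.const_mul
    ‖z‖).inv₀ (mul_ne_zero (norm_ne_zero_iff.2 hz0) (norm_ne_zero_iff.2 hG))
  refine h.congr fun n => ?_
  have hn : (0 : ℝ) < (n : ℝ) + 1 := by positivity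
  have hc : ‖((n + 1 : ℕ) : ℂ) ^ (-z)‖ = (((n : ℝ) + 1) ^ z.re)⁻¹ := by
    have := Complex.norm_cpow_eq_rpow_re_of_pos hn (-z)
    rw [Complex.neg_re, Real.rpow_neg hn.le] at this
    rw [← this]
    push_cast
    rfl
  have hz' : ‖z‖ ≠ 0 := norm_ne_zero_iff.2 hz0
  have hp := norm_ne_zero_iff.2 (cesaroProd_ne_zero hz (n + 1))
  have hr := (Real.rpow_pos_of_pos hn z.re).ne'
  simp only [Function.comp_apply]
  rw [GammaSeq_neg_succ, norm_div, norm_mul, norm_neg, hc]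
  field_simp

theorem tendsto_norm_cesaroProd_mul_rpow {z : ℂ} (hz0 : z ≠ 0)
    (hz : ∀ j : ℕ, z ≠ (j : ℂ) + 1) :
    Tendsto (fun n : ℕ => ‖cesaroProd z n‖ * ((n : ℝ) + 1) ^ z.re) atTop
      (𝓝 (‖z‖ * ‖Complex.Gamma (-z)‖)⁻¹) := by
  have h1 : Tendsto (fun n : ℕ => ‖1 - z / ((n : ℂ) + 1)‖) atTop (𝓝 1) := by
    have h := (tendsto_one_div_add_atTop_nhds_zero_nat (𝕜 := ℂ)).const_mul z
    have h' := (tendsto_const_nhds (x := (1 : ℂ))).sub h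
    simpa [div_eq_mul_inv] using h'.norm
  have h := (tendsto_norm_cesaroProd_succ_mul_rpow hz0 hz).div h1 one_ne_zero
  rw [div_one] at h
  refine h.congr fun n => ?_
  have hn := norm_ne_zero_iff.2 (one_sub_div_ne_zero hz n)
  simp only [Pi.div_apply]
  rw [cesaroProd_succ, norm_mul, mul_right_comm, mul_div_cancel_right₀ _ hn]

theorem exists_bounds_norm_cesaroProd_div {z : ℂ} (hz0 : z ≠ 0)
    (hz : ∀ j : ℕ, z ≠ (j : ℂ) + 1) :
    ∃ c C : ℝ, 0 < c ∧ 0 < C ∧ ∀ m n : ℕ,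
      c * (((n : ℝ) + 1) ^ z.re / ((m : ℝ) + 1) ^ z.re) ≤
        ‖cesaroProd z m / cesaroProd z (n + 1)‖ ∧
      ‖cesaroProd z m / cesaroProd z (n + 1)‖ ≤
        C * (((n : ℝ) + 1) ^ z.re / ((m : ℝ) + 1) ^ z.re) := by
  have hp : ∀ n, 0 < ‖cesaroProd z n‖ := fun n => norm_pos_iff.2 (cesaroProd_ne_zero hz n)
  have hr : ∀ n : ℕ, 0 < ((n : ℝ) + 1) ^ z.re := fun n => by positivity
  have ha : ∀ n : ℕ, 0 < ‖cesaroProd z (n + 1)‖ * ((n : ℝ) + 1) ^ z.re :=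
    fun n => mul_pos (hp _) (hr n)
  have hb : ∀ n : ℕ, 0 < ‖cesaroProd z n‖ * ((n : ℝ) + 1) ^ z.re :=
    fun n => mul_pos (hp _) (hr n)
  have hG : 0 < (‖z‖ * ‖Complex.Gamma (-z)‖)⁻¹ :=
    inv_pos.2 (mul_pos (norm_pos_iff.2 hz0) (norm_pos_iff.2 (Gamma_neg_ne_zero hz0 hz)))
  obtain ⟨c₁, C₁, hc₁, hC₁, h₁⟩ :=
    exists_bounds_of_tendsto_pos ha hG (tendsto_norm_cesaroProd_succ_mul_rpow hz0 hz)
  obtain ⟨c₂, C₂, hc₂, hC₂, h₂⟩ :=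
    exists_bounds_of_tendsto_pos hb hG (tendsto_norm_cesaroProd_mul_rpow hz0 hz)
  refine ⟨c₂ / C₁, C₂ / c₁, div_pos hc₂ hC₁, div_pos hC₂ hc₁, fun m n => ?_⟩
  have key : ‖cesaroProd z m / cesaroProd z (n + 1)‖ =
      (‖cesaroProd z m‖ * ((m : ℝ) + 1) ^ z.re) /
        (‖cesaroProd z (n + 1)‖ * ((n : ℝ) + 1) ^ z.re) *
        (((n : ℝ) + 1) ^ z.re / ((m : ℝ) + 1) ^ z.re) := by
    have := (hp (n + 1)).ne'
    have := (hr n).ne'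
    have := (hr m).ne'
    rw [norm_div]
    field_simp
  have hq : 0 ≤ ((n : ℝ) + 1) ^ z.re / ((m : ℝ) + 1) ^ z.re := (div_pos (hr n) (hr m)).le
  rw [key]
  exact ⟨mul_le_mul_of_nonneg_right
      (div_le_div₀ (hb m).le (h₂ m).1 (ha n) (h₁ n).2) hq,
    mul_le_mul_of_nonneg_right (div_le_div₀ hC₂.le (h₂ m).2 hc₁ (h₁ n).1) hq⟩

/-- If `u` solves `u n - z / (n + 1) * ∑_{k ≤ n} u k = z * v n`, its partial sums are explicit. -/
theorem cesaroProd_mul_sum_eq {z : ℂ} {u v : ℕ → ℂ}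
    (h : ∀ n : ℕ, u n - z / ((n : ℂ) + 1) * ∑ k ∈ Finset.range (n + 1), u k = z * v n) (n : ℕ) :
    cesaroProd z n * ∑ k ∈ Finset.range n, u k =
      ∑ k ∈ Finset.range n, z * v k * cesaroProd z k := by
  induction n with
  | zero => simp
  | succ n ih =>
    rw [Finset.sum_range_succ (fun k => z * v k * cesaroProd z k), ← ih, cesaroProd_succ]
    have hn := h n
    rw [Finset.sum_range_succ] at hn
    rw [Finset.sum_range_succ]
    linear_combination cesaroProd z n * hn

theorem exists_resolvent_solution {z : ℂ} (hz : ∀ j : ℕ, z ≠ (j : ℂ) + 1) (v : ℕ → ℂ) :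
    ∃ u : ℕ → ℂ, ∀ n : ℕ,
      u n - z / ((n : ℂ) + 1) * ∑ k ∈ Finset.range (n + 1), u k = z * v n := by
  let S : ℕ → ℂ := fun n =>
    (∑ k ∈ Finset.range n, z * v k * cesaroProd z k) / cesaroProd z n
  have hS : ∀ n, S (n + 1) * (1 - z / ((n : ℂ) + 1)) = S n + z * v n := by
    intro n
    have h1 := cesaroProd_ne_zero hz n
    have h2 := one_sub_div_ne_zero hz n
    simp only [S]
    rw [Finset.sum_range_succ, cesaroProd_succ, div_mul_eq_div_div, div_mul_cancel₀ _ h2, add_div,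
      mul_div_cancel_right₀ _ h1]
  let u : ℕ → ℂ := fun n => z * v n + z / ((n : ℂ) + 1) * S (n + 1)
  have hu : ∀ n, ∑ k ∈ Finset.range n, u k = S n := by
    intro n
    induction n with
    | zero => simp [S]
    | succ n ih =>
      rw [Finset.sum_range_succ, ih]
      simp only [u]
      linear_combination -(hS n)
  exact ⟨u, fun n => by rw [hu]; simp only [u]; ring⟩

/-- Up to constants, the modulus of the off-diagonal entries of the resolvent matrix. -/
def resolventKernel (w : ℕ → ℝ) (a : ℝ) (m n : ℕ) : ℝ :=
  w n / (w m * ((n : ℝ) + 1)) * (((n : ℝ) + 1) ^ a / ((m : ℝ) + 1) ^ a)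

theorem resolventKernel_nonneg {w : ℕ → ℝ} (hw : ∀ n, 0 < w n) (a : ℝ) (m n : ℕ) :
    0 ≤ resolventKernel w a m n := by
  have := hw m
  have := hw n
  unfold resolventKernel
  positivity

theorem resolventKernel_self_le_one {w : ℕ → ℝ} (hw : ∀ n, 0 < w n) (a : ℝ) (n : ℕ) :
    resolventKernel w a n n ≤ 1 := by
  have := (hw n).ne'
  have hr : ((n : ℝ) + 1) ^ a ≠ 0 := by positivity
  rw [resolventKernel, div_self hr, mul_one, div_mul_eq_div_div, div_self this]
  exact div_le_one_of_le₀ (by simp) (by positivity)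

theorem ofReal_mul_tsum_eq_tsum_resolventKernel {w : ℕ → ℝ} (hw : ∀ n, 0 < w n) (a : ℝ) (m : ℕ) :
    ENNReal.ofReal (1 / (((m : ℝ) + 1) ^ a * w m)) *
        ∑' k : ℕ, ENNReal.ofReal (w (m + 1 + k) / ((m : ℝ) + k + 2) ^ (1 - a)) =
      ∑' k : ℕ, ENNReal.ofReal (resolventKernel w a m (m + 1 + k)) := by
  have hm := hw m
  rw [← ENNReal.tsum_mul_left]
  refine tsum_congr fun k => ?_
  rw [← ENNReal.ofReal_mul (by positivity)]
  congr 1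
  have hpos : (0 : ℝ) < (m : ℝ) + k + 2 := by positivity
  have hcast : ((m + 1 + k : ℕ) : ℝ) + 1 = (m : ℝ) + k + 2 := by push_cast; ring
  rw [resolventKernel, hcast, Real.rpow_sub hpos, Real.rpow_one]
  have h1 : ((m : ℝ) + k + 2) ^ a ≠ 0 := by positivity
  have h2 : ((m : ℝ) + 1) ^ a ≠ 0 := by positivity
  field_simp

theorem ellOne_tsum_ofReal_norm (x : ellOne) :
    ∑' n, ENNReal.ofReal ‖(x : ∀ _ : ℕ, ℂ) n‖ = ENNReal.ofReal ‖x‖ := by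
  have hs : Summable fun n => ‖(x : ∀ _ : ℕ, ℂ) n‖ := by
    simpa using (memℓp_gen_iff (p := 1) (by simp)).1 (lp.memℓp x)
  rw [lp.norm_eq_tsum_rpow (by simp) x]
  simp only [ENNReal.toReal_one, Real.rpow_one, div_one]
  exact (ENNReal.ofReal_tsum_of_nonneg (fun _ => norm_nonneg _) hs).symm

theorem memℓp_one_of_tsum_ne_top {f : ℕ → ℂ} (h : ∑' n, ENNReal.ofReal ‖f n‖ ≠ ⊤) :
    Memℓp f 1 := by
  refine (memℓp_gen_iff (by simp)).2 ?_
  simpa [ENNReal.toReal_ofReal] using ENNReal.summable_toReal h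

theorem IsCesaroOp.sub_apply_eq_iff {w : ℕ → ℝ} (hw : ∀ n, 0 < w n) {T : ellOne →L[ℂ] ellOne}
    (hT : IsCesaroOp w w T) {z lam : ℂ} (hz : z * lam = 1) (x y : ellOne) :
    (algebraMap ℂ (ellOne →L[ℂ] ellOne) lam - T) x = y ↔
      ∀ n : ℕ, (x : ∀ _ : ℕ, ℂ) n / (w n : ℂ) -
        z / ((n : ℂ) + 1) * ∑ k ∈ Finset.range (n + 1), (x : ∀ _ : ℕ, ℂ) k / (w k : ℂ) =
          z * ((y : ∀ _ : ℕ, ℂ) n / (w n : ℂ)) := by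
  have hz0 : z ≠ 0 := left_ne_zero_of_mul_eq_one hz
  rw [lp.ext_iff, funext_iff]
  refine forall_congr' fun n => ?_
  have hwn : (w n : ℂ) ≠ 0 := Complex.ofReal_ne_zero.2 (hw n).ne'
  have hL : ((algebraMap ℂ (ellOne →L[ℂ] ellOne) lam - T) x : ∀ _ : ℕ, ℂ) n =
      lam * (x : ∀ _ : ℕ, ℂ) n - (w n : ℂ) / ((n : ℂ) + 1) *
        ∑ k ∈ Finset.range (n + 1), (x : ∀ _ : ℕ, ℂ) k / (w k : ℂ) := by
    have h1 : (algebraMap ℂ (ellOne →L[ℂ] ellOne) lam - T) x = lam • x - T x := by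
      simp [Algebra.algebraMap_eq_smul_one]
    rw [h1, lp.coeFn_sub, Pi.sub_apply, hT x n, lp.coeFn_smul, Pi.smul_apply, smul_eq_mul]
    push_cast
    rfl
  rw [hL]
  generalize ∑ k ∈ Finset.range (n + 1), (x : ∀ _ : ℕ, ℂ) k / (w k : ℂ) = S
  have h1 : (n : ℂ) + 1 ≠ 0 := Nat.cast_add_one_ne_zero n
  constructor
  · intro h
    rw [← h]
    field_simp
    linear_combination (-((n : ℂ) + 1) * (x : ∀ _ : ℕ, ℂ) n) * hz
  · intro h
    field_simp at h ⊢
    refine mul_left_cancel₀ hz0 ?_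
    linear_combination h + (((n : ℂ) + 1) * (x : ∀ _ : ℕ, ℂ) n) * hz

theorem IsCesaroOp.sub_injective {w : ℕ → ℝ} (hw : ∀ n, 0 < w n) {T : ellOne →L[ℂ] ellOne}
    (hT : IsCesaroOp w w T) {z lam : ℂ} (hz : z * lam = 1) (hzn : ∀ j : ℕ, z ≠ (j : ℂ) + 1) :
    Function.Injective (algebraMap ℂ (ellOne →L[ℂ] ellOne) lam - T) := by
  refine (injective_iff_map_eq_zero _).2 fun x hx => ?_
  have h := (hT.sub_apply_eq_iff hw hz x 0).1 hx
  have hS := cesaroProd_mul_sum_eq h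
  have hsum : ∀ n : ℕ, ∑ k ∈ Finset.range n, (x : ∀ _ : ℕ, ℂ) k / (w k : ℂ) = 0 := fun n => by
    have := hS n
    simpa [cesaroProd_ne_zero hzn n] using this
  ext n
  have hwn : (w n : ℂ) ≠ 0 := Complex.ofReal_ne_zero.2 (hw n).ne'
  have := h n
  rw [hsum] at this
  simpa [hwn] using this

theorem iSup_tsum_resolventKernel_ne_top_of_isUnit {w : ℕ → ℝ} (hw : ∀ n, 0 < w n)
    {T : ellOne →L[ℂ] ellOne} (hT : IsCesaroOp w w T) {z lam : ℂ} (hz : z * lam = 1)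
    (hzn : ∀ j : ℕ, z ≠ (j : ℂ) + 1)
    (hU : IsUnit (algebraMap ℂ (ellOne →L[ℂ] ellOne) lam - T)) :
    (⨆ m : ℕ, ∑' k : ℕ, ENNReal.ofReal (resolventKernel w z.re m (m + 1 + k))) ≠ ⊤ := by
  have hz0 : z ≠ 0 := left_ne_zero_of_mul_eq_one hz
  obtain ⟨c, C, hc, -, hb⟩ := exists_bounds_norm_cesaroProd_div hz0 hzn
  obtain ⟨R, hR⟩ := hU.exists_right_inv
  have hd : 0 < ‖z‖ ^ 2 * c := by positivity
  refine ne_top_of_le_ne_top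
    (ENNReal.ofReal_ne_top (r := (‖z‖ ^ 2 * c)⁻¹ * ‖R‖)) (iSup_le fun m => ?_)
  let e : ellOne := lp.single 1 m 1
  have he : ‖e‖ = 1 := by simp [e]
  have hx : (algebraMap ℂ (ellOne →L[ℂ] ellOne) lam - T) (R e) = e := by
    simpa using DFunLike.congr_fun hR e
  have hRe : ‖R e‖ ≤ ‖R‖ := by simpa [he] using R.le_opNorm e
  have h := (hT.sub_apply_eq_iff hw hz (R e) e).1 hx
  have hS := cesaroProd_mul_sum_eq h
  have hentry : ∀ n, m < n →
      ‖z‖ ^ 2 * c * resolventKernel w z.re m n ≤ ‖(R e : ∀ _ : ℕ, ℂ) n‖ := by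
    intro n hn
    have hwn := hw n
    have hwm := hw m
    have hwn' : (w n : ℂ) ≠ 0 := Complex.ofReal_ne_zero.2 hwn.ne'
    have hn1 : (n : ℂ) + 1 ≠ 0 := Nat.cast_add_one_ne_zero n
    have hP := cesaroProd_ne_zero hzn (n + 1)
    have hen : (e : ∀ _ : ℕ, ℂ) n = 0 := lp.single_apply_ne _ _ _ hn.ne'
    have hsum : ∑ k ∈ Finset.range (n + 1),
        z * ((e : ∀ _ : ℕ, ℂ) k / (w k : ℂ)) * cesaroProd z k =
          z / (w m : ℂ) * cesaroProd z m := by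
      rw [Finset.sum_eq_single_of_mem m (Finset.mem_range.2 (by omega))]
      · rw [show (e : ∀ _ : ℕ, ℂ) m = 1 from lp.single_apply_self _ _ _]
        ring
      · intro k _ hk
        rw [show (e : ∀ _ : ℕ, ℂ) k = 0 from lp.single_apply_ne _ _ _ hk]
        ring
    have hSn : ∑ k ∈ Finset.range (n + 1), (R e : ∀ _ : ℕ, ℂ) k / (w k : ℂ) =
        z / (w m : ℂ) * (cesaroProd z m / cesaroProd z (n + 1)) := by
      rw [mul_div_assoc', eq_div_iff hP, ← hsum, ← hS, mul_comm]
    have hxn := h n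
    rw [hSn, hen, zero_div, mul_zero, sub_eq_zero, div_eq_iff hwn'] at hxn
    have hnorm1 : ‖(n : ℂ) + 1‖ = (n : ℝ) + 1 := by
      exact_mod_cast Complex.norm_natCast (n + 1)
    rw [hxn, norm_mul, norm_mul, norm_mul, norm_div, norm_div, hnorm1, Complex.norm_real,
      Complex.norm_real, Real.norm_of_nonneg hwn.le, Real.norm_of_nonneg hwm.le]
    calc ‖z‖ ^ 2 * c * resolventKernel w z.re m n
        = ‖z‖ / ((n : ℝ) + 1) * (‖z‖ / w m *
            (c * (((n : ℝ) + 1) ^ z.re / ((m : ℝ) + 1) ^ z.re))) * w n := by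
          rw [resolventKernel]
          field_simp
      _ ≤ _ := by
          gcongr
          exact (hb m n).1
  have hterm : ∀ n, m < n → resolventKernel w z.re m n ≤
      (‖z‖ ^ 2 * c)⁻¹ * ‖(R e : ∀ _ : ℕ, ℂ) n‖ := fun n hn => by
    rw [inv_mul_eq_div, le_div_iff₀' hd]
    exact hentry n hn
  calc ∑' k : ℕ, ENNReal.ofReal (resolventKernel w z.re m (m + 1 + k))
      ≤ ∑' k : ℕ, ENNReal.ofReal (‖z‖ ^ 2 * c)⁻¹ *
          ENNReal.ofReal ‖(R e : ∀ _ : ℕ, ℂ) (m + 1 + k)‖ := by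
        refine ENNReal.tsum_le_tsum fun k => ?_
        rw [← ENNReal.ofReal_mul (inv_pos.2 hd).le]
        exact ENNReal.ofReal_le_ofReal (hterm _ (by omega))
    _ = ENNReal.ofReal (‖z‖ ^ 2 * c)⁻¹ *
          ∑' k : ℕ, ENNReal.ofReal ‖(R e : ∀ _ : ℕ, ℂ) (m + 1 + k)‖ := ENNReal.tsum_mul_left
    _ ≤ ENNReal.ofReal (‖z‖ ^ 2 * c)⁻¹ * ENNReal.ofReal ‖R e‖ := by
        gcongr
        rw [← ellOne_tsum_ofReal_norm]
        exact ENNReal.tsum_comp_le_tsum_of_injective (add_right_injective (m + 1))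
          fun n => ENNReal.ofReal ‖(R e : ∀ _ : ℕ, ℂ) n‖
    _ ≤ ENNReal.ofReal ((‖z‖ ^ 2 * c)⁻¹ * ‖R‖) := by
        rw [← ENNReal.ofReal_mul (inv_pos.2 hd).le]
        exact ENNReal.ofReal_le_ofReal (mul_le_mul_of_nonneg_left hRe (inv_pos.2 hd).le)

theorem tsum_sum_resolventKernel_ne_top {w : ℕ → ℝ} (hw : ∀ n, 0 < w n) {a : ℝ}
    (hK : (⨆ m : ℕ, ∑' k : ℕ, ENNReal.ofReal (resolventKernel w a m (m + 1 + k))) ≠ ⊤)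
    (y : ellOne) :
    ∑' n : ℕ, ∑ k ∈ Finset.range (n + 1),
      ENNReal.ofReal ‖(y : ∀ _ : ℕ, ℂ) k‖ * ENNReal.ofReal (resolventKernel w a k n) ≠ ⊤ := by
  let G : ℕ → ℕ → ENNReal := fun k n =>
    if k ≤ n then ENNReal.ofReal (resolventKernel w a k n) else 0
  have hG : ∀ k, ∑' n, G k n ≤
      1 + ⨆ m : ℕ, ∑' j : ℕ, ENNReal.ofReal (resolventKernel w a m (m + 1 + j)) := by
    intro k
    rw [← Summable.sum_add_tsum_nat_add' (f := G k) (k := k + 1) ENNReal.summable]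
    refine add_le_add ?_ ?_
    · rw [Finset.sum_eq_single_of_mem k (by simp)]
      · simpa [G] using resolventKernel_self_le_one hw a k
      · intro n hn hnk
        exact if_neg (by have := Finset.mem_range.1 hn; omega)
    · refine le_trans (le_of_eq (tsum_congr fun j => ?_))
        (le_iSup (fun m : ℕ => ∑' j : ℕ, ENNReal.ofReal (resolventKernel w a m (m + 1 + j))) k)
      rw [add_comm j]
      exact if_pos (by omega)
  have hinner : ∀ n, ∑ k ∈ Finset.range (n + 1),
      ENNReal.ofReal ‖(y : ∀ _ : ℕ, ℂ) k‖ * ENNReal.ofReal (resolventKernel w a k n) ≤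
        ∑' k, ENNReal.ofReal ‖(y : ∀ _ : ℕ, ℂ) k‖ * G k n := fun n => by
    refine le_trans (le_of_eq (Finset.sum_congr rfl fun k hk => ?_))
      (ENNReal.sum_le_tsum (Finset.range (n + 1)))
    rw [show G k n = _ from if_pos (Finset.mem_range_succ_iff.1 hk)]
  refine ne_top_of_le_ne_top (ENNReal.mul_ne_top (ENNReal.ofReal_ne_top (r := ‖y‖))
    (ENNReal.add_ne_top.2 ⟨ENNReal.one_ne_top, hK⟩)) ?_
  calc _ ≤ ∑' n, ∑' k, ENNReal.ofReal ‖(y : ∀ _ : ℕ, ℂ) k‖ * G k n := ENNReal.tsum_le_tsum hinner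
    _ = ∑' k, ENNReal.ofReal ‖(y : ∀ _ : ℕ, ℂ) k‖ * ∑' n, G k n := by
        rw [ENNReal.tsum_comm]
        simp_rw [ENNReal.tsum_mul_left]
    _ ≤ ∑' k, ENNReal.ofReal ‖(y : ∀ _ : ℕ, ℂ) k‖ *
          (1 + ⨆ m : ℕ, ∑' j : ℕ, ENNReal.ofReal (resolventKernel w a m (m + 1 + j))) :=
        ENNReal.tsum_le_tsum fun k => mul_le_mul_right (hG k) _
    _ = _ := by rw [ENNReal.tsum_mul_right, ellOne_tsum_ofReal_norm]

theorem IsCesaroOp.sub_surjective {w : ℕ → ℝ} (hw : ∀ n, 0 < w n) {T : ellOne →L[ℂ] ellOne}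
    (hT : IsCesaroOp w w T) {z lam : ℂ} (hz : z * lam = 1) (hzn : ∀ j : ℕ, z ≠ (j : ℂ) + 1)
    (hK : (⨆ m : ℕ, ∑' k : ℕ, ENNReal.ofReal (resolventKernel w z.re m (m + 1 + k))) ≠ ⊤) :
    Function.Surjective (algebraMap ℂ (ellOne →L[ℂ] ellOne) lam - T) := by
  intro y
  have hz0 : z ≠ 0 := left_ne_zero_of_mul_eq_one hz
  obtain ⟨c, C, -, hC, hb⟩ := exists_bounds_norm_cesaroProd_div hz0 hzn
  obtain ⟨u, hu⟩ := exists_resolvent_solution hzn fun n => (y : ∀ _ : ℕ, ℂ) n / (w n : ℂ)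
  have hS := cesaroProd_mul_sum_eq hu
  have hbound : ∀ n, ‖(w n : ℂ) * u n‖ ≤ ‖z‖ * ‖(y : ∀ _ : ℕ, ℂ) n‖ +
      ‖z‖ ^ 2 * C * ∑ k ∈ Finset.range (n + 1),
        ‖(y : ∀ _ : ℕ, ℂ) k‖ * resolventKernel w z.re k n := by
    intro n
    have hwn := hw n
    have hwn' : (w n : ℂ) ≠ 0 := Complex.ofReal_ne_zero.2 hwn.ne'
    have hP := cesaroProd_ne_zero hzn (n + 1)
    have hSn : ∑ k ∈ Finset.range (n + 1), u k = ∑ k ∈ Finset.range (n + 1),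
        z * ((y : ∀ _ : ℕ, ℂ) k / (w k : ℂ)) * (cesaroProd z k / cesaroProd z (n + 1)) := by
      rw [← mul_right_inj' hP, hS, Finset.mul_sum]
      refine Finset.sum_congr rfl fun k _ => ?_
      rw [mul_left_comm, mul_div_cancel₀ _ hP]
    have hun : (w n : ℂ) * u n = z * (y : ∀ _ : ℕ, ℂ) n +
        ∑ k ∈ Finset.range (n + 1), (w n : ℂ) * (z / ((n : ℂ) + 1)) *
          (z * ((y : ∀ _ : ℕ, ℂ) k / (w k : ℂ)) * (cesaroProd z k / cesaroProd z (n + 1))) := by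
      rw [← Finset.mul_sum, ← hSn, eq_add_of_sub_eq (hu n)]
      field_simp
    have hnorm1 : ‖(n : ℂ) + 1‖ = (n : ℝ) + 1 := by
      exact_mod_cast Complex.norm_natCast (n + 1)
    rw [hun]
    refine (norm_add_le _ _).trans (add_le_add (norm_mul_le _ _) ?_)
    rw [Finset.mul_sum]
    refine norm_sum_le_of_le _ fun k _ => ?_
    have hwk := hw k
    rw [norm_mul, norm_mul, norm_mul, norm_mul, norm_div, norm_div, hnorm1, Complex.norm_real,
      Complex.norm_real, Real.norm_of_nonneg hwn.le, Real.norm_of_nonneg hwk.le]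
    calc _ ≤ w n * (‖z‖ / ((n : ℝ) + 1)) * (‖z‖ * (‖(y : ∀ _ : ℕ, ℂ) k‖ / w k) *
            (C * (((n : ℝ) + 1) ^ z.re / ((k : ℝ) + 1) ^ z.re))) := by
          gcongr
          exact (hb k n).2
      _ = _ := by
          rw [resolventKernel]
          field_simp
  have hmem : Memℓp (fun n => (w n : ℂ) * u n) 1 := by
    refine memℓp_one_of_tsum_ne_top (ne_top_of_le_ne_top ?_
      (ENNReal.tsum_le_tsum fun n => ENNReal.ofReal_le_ofReal (hbound n)))
    have hsplit : ∀ n, ENNReal.ofReal (‖z‖ * ‖(y : ∀ _ : ℕ, ℂ) n‖ +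
        ‖z‖ ^ 2 * C * ∑ k ∈ Finset.range (n + 1),
          ‖(y : ∀ _ : ℕ, ℂ) k‖ * resolventKernel w z.re k n) =
        ENNReal.ofReal ‖z‖ * ENNReal.ofReal ‖(y : ∀ _ : ℕ, ℂ) n‖ +
        ENNReal.ofReal (‖z‖ ^ 2 * C) * ∑ k ∈ Finset.range (n + 1),
          ENNReal.ofReal ‖(y : ∀ _ : ℕ, ℂ) k‖ *
            ENNReal.ofReal (resolventKernel w z.re k n) := by
      intro n
      have hnn : ∀ k ∈ Finset.range (n + 1),
          0 ≤ ‖(y : ∀ _ : ℕ, ℂ) k‖ * resolventKernel w z.re k n :=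
        fun k _ => mul_nonneg (norm_nonneg _) (resolventKernel_nonneg hw _ _ _)
      rw [ENNReal.ofReal_add (by positivity)
        (mul_nonneg (by positivity) (Finset.sum_nonneg hnn)), ENNReal.ofReal_mul (norm_nonneg _),
        ENNReal.ofReal_mul (by positivity), ENNReal.ofReal_sum_of_nonneg hnn]
      simp_rw [ENNReal.ofReal_mul (norm_nonneg _)]
    simp_rw [hsplit]
    rw [ENNReal.tsum_add, ENNReal.tsum_mul_left, ENNReal.tsum_mul_left, ellOne_tsum_ofReal_norm]
    exact ENNReal.add_ne_top.2 ⟨ENNReal.mul_ne_top ENNReal.ofReal_ne_top ENNReal.ofReal_ne_top,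
      ENNReal.mul_ne_top ENNReal.ofReal_ne_top (tsum_sum_resolventKernel_ne_top hw hK y)⟩
  refine ⟨⟨fun n => (w n : ℂ) * u n, hmem⟩, (hT.sub_apply_eq_iff hw hz _ y).2 fun n => ?_⟩
  have hdiv : ∀ k, (w k : ℂ) * u k / (w k : ℂ) = u k := fun k =>
    mul_div_cancel_left₀ _ (Complex.ofReal_ne_zero.2 (hw k).ne')
  simp only [hdiv]
  exact hu n

theorem resolvent_characterization (w : ℕ → ℝ)
    (hw : ∀ n, 0 < w n) (hwb : ∃ C, ∀ n, w n ≤ C)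
    (hM : Mvw w w ≠ ⊤)
    (T : ellOne →L[ℂ] ellOne) (hT : IsCesaroOp w w T)
    (lam : ℂ) (hlam : lam ∉ ({0} ∪ {z : ℂ | ∃ m : ℕ, 1 ≤ m ∧ z = ((m : ℂ))⁻¹} : Set ℂ)) :
    lam ∉ spectrum ℂ T ↔
      (⨆ m : ℕ, ENNReal.ofReal (1 / (((m : ℝ) + 1) ^ ((1 / lam).re) * w m)) *
          ∑' k : ℕ, ENNReal.ofReal (w (m + 1 + k) / ((m : ℝ) + k + 2) ^ (1 - (1 / lam).re)))
        ≠ ⊤ := by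
  simp only [Set.singleton_union, Set.mem_insert_iff, Set.mem_ofPred_eq, not_or, not_exists,
    not_and] at hlam
  obtain ⟨hlam0, hlamm⟩ := hlam
  have hz : 1 / lam * lam = 1 := one_div_mul_cancel hlam0
  have hzn : ∀ j : ℕ, 1 / lam ≠ (j : ℂ) + 1 := fun j hj =>
    hlamm (j + 1) (by omega) (by rw [Nat.cast_succ, ← hj, one_div, inv_inv])
  simp_rw [ofReal_mul_tsum_eq_tsum_resolventKernel hw]
  rw [spectrum.notMem_iff]
  exact ⟨iSup_tsum_resolventKernel_ne_top_of_isUnit hw hT hz hzn, fun hK =>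
    ContinuousLinearMap.isUnit_iff_bijective.2
      ⟨hT.sub_injective hw hz hzn, hT.sub_surjective hw hz hzn hK⟩⟩
end
end

section
/- Let w be a weight with M_w < ∞ and let T : ℓ¹ → ℓ¹ be the continuous linear operator satisfying (T x)(n) = (w(n)/n) ∑_{k=1}^n x(k)/w(k) for all x ∈ ℓ¹ and n ≥ 1. Suppose T is a compact operator. Then: (i) the set of eigenvalues of T equals {1/m : m ∈ ℕ, m ≥ 1} and σ(T) = {0} ∪ {1/m : m ∈ ℕ, m ≥ 1}; (ii) w is rapidly decreasing, i.e., ∑_{n≥1} n^k w(n) < ∞ for every k ∈ ℕ. -/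
/- STATEMENT 12: If T (the transferred Cesàro operator) is compact, then its eigenvalue set
equals {1/m : m ≥ 1}, σ(T) = {0} ∪ {1/m : m ≥ 1}, and w is rapidly decreasing.
Index `n : ℕ` corresponds to the paper's `n+1`. -/

open Filter Topology

noncomputable section

namespace IsCesaroOp

variable {w : ℕ → ℝ} {T : ellOne →L[ℂ] ellOne}

/-- The matrix of a Cesàro operator is lower triangular with diagonal entries `1 / (n + 1)`. -/
theorem apply_of_forall_lt_eq_zero (hT : IsCesaroOp w w T) (hw : ∀ n, 0 < w n) {x : ellOne} {n : ℕ}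
    (hx : ∀ k < n, x k = 0) : T x n = ((n : ℂ) + 1)⁻¹ * x n := by
  have hn : (w n : ℂ) ≠ 0 := by exact_mod_cast (hw n).ne'
  have hn' : (n : ℂ) + 1 ≠ 0 := by exact_mod_cast n.succ_ne_zero
  rw [hT, Finset.sum_range_succ, Finset.sum_eq_zero fun k hk => by
    rw [hx k (Finset.mem_range.mp hk), zero_div]]
  push_cast
  field_simp
  ring

theorem exists_first_nonzero (hT : IsCesaroOp w w T) (hw : ∀ n, 0 < w n) {x : ellOne} (hx : x ≠ 0)
    {lam : ℂ} (h : T x = lam • x) :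
    ∃ n : ℕ, lam = ((n : ℂ) + 1)⁻¹ ∧ x n ≠ 0 ∧ ∀ k < n, x k = 0 := by
  classical
  have hex : ∃ n, x n ≠ 0 := by
    by_contra! h0
    exact hx (lp.ext (funext h0))
  have hlt : ∀ k < Nat.find hex, x k = 0 := fun k hk => not_not.mp (Nat.find_min hex hk)
  refine ⟨Nat.find hex, ?_, Nat.find_spec hex, hlt⟩
  have h1 := hT.apply_of_forall_lt_eq_zero hw hlt
  rw [h] at h1
  exact mul_right_cancel₀ (Nat.find_spec hex) h1

theorem inv_succ_mem_spectrum (hT : IsCesaroOp w w T) (hw : ∀ n, 0 < w n) (m : ℕ) :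
    ((m : ℂ) + 1)⁻¹ ∈ spectrum ℂ T := by
  intro hu
  obtain ⟨x, hx⟩ := (ContinuousLinearMap.isUnit_iff_bijective.mp hu).2 (lp.single 1 m (1 : ℂ))
  have hcoord (n : ℕ) :
      ((m : ℂ) + 1)⁻¹ * x n - T x n = (lp.single 1 m (1 : ℂ) : ellOne) n := by
    rw [← hx]
    simp [Algebra.algebraMap_eq_smul_one]
    rfl
  have hzero (n : ℕ) : n < m → x n = 0 := by
    induction n using Nat.strong_induction_on with
    | _ n ih =>
      intro hn
      have h := hcoord n
      rw [hT.apply_of_forall_lt_eq_zero hw fun k hk => ih k hk (hk.trans hn),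
        lp.single_apply_ne _ _ _ hn.ne, ← sub_mul] at h
      refine (mul_eq_zero.mp h).resolve_left (sub_ne_zero.mpr fun he => hn.ne' ?_)
      exact_mod_cast add_right_cancel (inv_injective he)
  have h := hcoord m
  rw [hT.apply_of_forall_lt_eq_zero hw hzero, sub_self, lp.single_apply_self] at h
  exact zero_ne_one h

theorem zero_mem_spectrum (hT : IsCesaroOp w w T) (hw : ∀ n, 0 < w n) : 0 ∈ spectrum ℂ T := by
  refine (spectrum.isClosed T).mem_of_tendsto (f := fun m : ℕ => ((m : ℂ) + 1)⁻¹) (b := atTop) ?_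
    (Eventually.of_forall (hT.inv_succ_mem_spectrum hw))
  simpa [one_div] using tendsto_one_div_add_atTop_nhds_zero_nat (𝕜 := ℂ)

theorem exists_eigenvector_iff_mem_spectrum (hcomp : IsCompactOperator T) {lam : ℂ}
    (hlam : lam ≠ 0) : (∃ x : ellOne, x ≠ 0 ∧ T x = lam • x) ↔ lam ∈ spectrum ℂ T := by
  rw [← hcomp.hasEigenvalue_iff_mem_spectrum hlam]
  constructor
  · rintro ⟨x, hx, h⟩
    exact Module.End.hasEigenvalue_of_hasEigenvector
      ⟨Module.End.mem_eigenspace_iff.mpr h, hx⟩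
  · intro h
    obtain ⟨x, hx⟩ := h.exists_hasEigenvector
    exact ⟨x, hx.2, hx.apply_eq_smul⟩

theorem exists_eigenvector_iff (hT : IsCesaroOp w w T) (hw : ∀ n, 0 < w n)
    (hcomp : IsCompactOperator T) {lam : ℂ} :
    (∃ x : ellOne, x ≠ 0 ∧ T x = lam • x) ↔ ∃ m : ℕ, 1 ≤ m ∧ lam = (m : ℂ)⁻¹ := by
  constructor
  · rintro ⟨x, hx, h⟩
    obtain ⟨n, hn, -⟩ := hT.exists_first_nonzero hw hx h
    exact ⟨n + 1, n.succ_pos, by exact_mod_cast hn⟩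
  · rintro ⟨m, hm, rfl⟩
    rw [exists_eigenvector_iff_mem_spectrum hcomp (inv_ne_zero (by exact_mod_cast (by lia)))]
    obtain ⟨n, rfl⟩ := Nat.exists_eq_add_of_le' hm
    exact_mod_cast hT.inv_succ_mem_spectrum hw n

/-- Up to the weight, the eigenvectors for `1 / (k + 1)` are multiples of `n ↦ n.choose k`. -/
theorem eigenvector_apply (hT : IsCesaroOp w w T) (hw : ∀ n, 0 < w n) {x : ellOne} {k : ℕ}
    (h : T x = ((k : ℂ) + 1)⁻¹ • x) {n : ℕ} (hn : k ≤ n) :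
    x n / w n = n.choose k * (x k / w k) := by
  have hk' : (k : ℂ) + 1 ≠ 0 := by exact_mod_cast k.succ_ne_zero
  have hsum (n : ℕ) :
      ((k : ℂ) + 1) * ∑ j ∈ Finset.range (n + 1), x j / (w j : ℂ) = (n + 1) * (x n / w n) := by
    have hn : (w n : ℂ) ≠ 0 := by exact_mod_cast (hw n).ne'
    have hn' : (n : ℂ) + 1 ≠ 0 := by exact_mod_cast n.succ_ne_zero
    have h1 := hT x n
    have h2 : T x n = ((k : ℂ) + 1)⁻¹ * x n := by rw [h]; rfl
    rw [h2] at h1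
    push_cast at h1
    field_simp at h1 ⊢
    linear_combination -h1
  induction n, hn using Nat.le_induction with
  | base => simp
  | succ n hn ih =>
    have h1 := hsum (n + 1)
    rw [Finset.sum_range_succ, mul_add, hsum n, ih] at h1
    have hne : (n : ℂ) + 1 - k ≠ 0 := by
      rw [sub_ne_zero]
      exact_mod_cast (by lia : n + 1 ≠ k)
    have hc : (n.choose k : ℂ) * (n + 1) = (n + 1).choose k * (n + 1 - k) := by
      have := congrArg (Nat.cast (R := ℂ)) (Nat.choose_mul_succ_eq n k)
      rw [Nat.cast_mul, Nat.cast_mul, Nat.cast_sub (by lia)] at this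
      exact_mod_cast this
    push_cast at h1
    refine mul_left_cancel₀ hne ?_
    linear_combination -h1 + (x k / w k) * hc

theorem summable_choose_mul (hT : IsCesaroOp w w T) (hw : ∀ n, 0 < w n)
    (hcomp : IsCompactOperator T) (k : ℕ) : Summable fun n : ℕ => (n.choose k : ℝ) * w n := by
  obtain ⟨x, hx, h⟩ := (hT.exists_eigenvector_iff hw hcomp (lam := ((k : ℂ) + 1)⁻¹)).mpr
    ⟨k + 1, k.succ_pos, by push_cast; rfl⟩
  obtain ⟨j, hj, hxj, -⟩ := hT.exists_first_nonzero hw hx h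
  obtain rfl : k = j := by exact_mod_cast add_right_cancel (inv_injective hj)
  have hsum : Summable fun n => ‖x n‖ := by simpa using (lp.memℓp x).summable (by simp)
  refine Summable.of_norm_bounded_eventually_nat (hsum.mul_right (w k / ‖x k‖)) ?_
  filter_upwards [eventually_ge_atTop k] with n hn
  have h1 := congrArg norm (hT.eigenvector_apply hw h hn)
  have hxj' : ‖x k‖ ≠ 0 := norm_ne_zero_iff.mpr hxj
  have hk := (hw k).ne'
  have hn0 := (hw n).ne'
  rw [norm_mul, norm_div, norm_div, Complex.norm_natCast, Complex.norm_of_nonneg (hw n).le,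
    Complex.norm_of_nonneg (hw k).le] at h1
  rw [Real.norm_of_nonneg (mul_nonneg (Nat.cast_nonneg _) (hw n).le)]
  field_simp at h1 ⊢
  linarith

end IsCesaroOp

theorem Nat.succ_pow_le_two_pow_mul_factorial_mul_choose {n k : ℕ} (h : 2 * k ≤ n) :
    (n + 1) ^ k ≤ 2 ^ k * k.factorial * n.choose k := by
  calc (n + 1) ^ k ≤ (2 * (n + 1 - k)) ^ k := Nat.pow_le_pow_left (by lia) k
    _ = 2 ^ k * (n + 1 - k) ^ k := mul_pow ..
    _ ≤ 2 ^ k * n.descFactorial k := Nat.mul_le_mul_left _ (Nat.pow_sub_le_descFactorial n k)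
    _ = 2 ^ k * k.factorial * n.choose k := by
      rw [Nat.descFactorial_eq_factorial_mul_choose, mul_assoc]

theorem compact_cesaro_spectrum (w : ℕ → ℝ)
    (hw : ∀ n, 0 < w n) (hwb : ∃ C, ∀ n, w n ≤ C)
    (hM : Mvw w w ≠ ⊤)
    (T : ellOne →L[ℂ] ellOne) (hT : IsCesaroOp w w T)
    (hcomp : IsCompactOperator T) :
    ({lam : ℂ | ∃ x : ellOne, x ≠ 0 ∧ T x = lam • x}
        = {z : ℂ | ∃ m : ℕ, 1 ≤ m ∧ z = ((m : ℂ))⁻¹}) ∧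
      (spectrum ℂ T = {0} ∪ {z : ℂ | ∃ m : ℕ, 1 ≤ m ∧ z = ((m : ℂ))⁻¹}) ∧
      (∀ k : ℕ, Summable fun n : ℕ => ((n : ℝ) + 1) ^ k * w n) := by
  refine ⟨Set.ext fun lam => hT.exists_eigenvector_iff hw hcomp, Set.ext fun lam => ?_,
    fun k => ?_⟩
  · rcases eq_or_ne lam 0 with rfl | hlam
    · simp [hT.zero_mem_spectrum hw]
    · rw [← IsCesaroOp.exists_eigenvector_iff_mem_spectrum hcomp hlam,
        hT.exists_eigenvector_iff hw hcomp]
      simp [hlam]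
  · refine Summable.of_norm_bounded_eventually_nat
      ((hT.summable_choose_mul hw hcomp k).mul_left (2 ^ k * k.factorial : ℝ)) ?_
    filter_upwards [eventually_ge_atTop (2 * k)] with n hn
    rw [Real.norm_of_nonneg (mul_nonneg (by positivity) (hw n).le), ← mul_assoc]
    refine mul_le_mul_of_nonneg_right ?_ (hw n).le
    exact_mod_cast Nat.succ_pow_le_two_pow_mul_factorial_mul_choose hn
end
end

section
/- Let w be a weight with ∑_{n≥1} w(n) < ∞ and M_w < ∞, let T : ℓ¹ → ℓ¹ be the continuous linear operator satisfying (T x)(n) = (w(n)/n) ∑_{k=1}^n x(k)/w(k) for all x ∈ ℓ¹ and n ≥ 1, and set X₁ := {x ∈ ℓ¹ : x(1) = 0}. The following conditions are equivalent: (i) the range of I − T is closed in ℓ¹; (ii) the range of I − T equals X₁; (iii) (I − T)(X₁) = X₁; (iv) 𝒰_w := sup_{m≥1} (1/(m·w(m+1))) ∑_{n=m+1}^∞ w(n) < ∞. -/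
/- STATEMENT 17: With ∑ w(n) < ∞ and M_w < ∞, for the transferred Cesàro operator T on ℓ¹
and X₁ = {x : x(1) = 0} (0-indexed: x 0 = 0), the following are equivalent:
(i) range(I − T) closed; (ii) range(I − T) = X₁; (iii) (I − T)(X₁) = X₁;
(iv) 𝒰_w = sup_{m≥1} (1/(m w(m+1))) ∑_{n=m+1}^∞ w(n) < ∞.
Index `n : ℕ` corresponds to the paper's `n+1`; in the 0-indexed form,
𝒰_w = sup_{i : ℕ} (1/((i+1)·w(i+1))) ∑_{j≥i+1} w(j). -/

open Filter Topology

noncomputable section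

/-- `𝒰_w = sup_{m≥1} (1/(m·w(m+1))) ∑_{n=m+1}^∞ w(n)` in `ℝ≥0∞` (0-indexed). -/
def Uw (w : ℕ → ℝ) : ENNReal :=
  ⨆ i : ℕ, ENNReal.ofReal (1 / (((i : ℝ) + 1) * w (i + 1))) *
    ∑' k : ℕ, ENNReal.ofReal (w (i + 1 + k))

/-- The solution `x` of `x - T x = y` with `x 0 = 0`, for a sequence `y` with `y 0 = 0`. -/
def cesaroResolve (w : ℕ → ℝ) (y : ℕ → ℂ) (n : ℕ) : ℂ :=
  y n + w n * ∑ k ∈ Finset.range n, y (k + 1) / ((k + 1) * w (k + 1))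

lemma sum_cesaroResolve_div {w : ℕ → ℝ} (hw : ∀ n, 0 < w n) {y : ℕ → ℂ} (hy : y 0 = 0) (n : ℕ) :
    ∑ k ∈ Finset.range (n + 1), cesaroResolve w y k / w k
      = (n + 1) * ∑ k ∈ Finset.range n, y (k + 1) / ((k + 1) * w (k + 1)) := by
  induction n with
  | zero => simp [cesaroResolve, hy]
  | succ n ih =>
    have h1 : (w (n + 1) : ℂ) ≠ 0 := by exact_mod_cast (hw (n + 1)).ne'
    have h2 : (n + 1 : ℂ) ≠ 0 := by exact_mod_cast n.succ_ne_zero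
    rw [Finset.sum_range_succ, ih, cesaroResolve, Finset.sum_range_succ]
    push_cast
    field_simp
    ring

lemma eq_cesaroResolve_of_sub {w : ℕ → ℝ} (hw : ∀ n, 0 < w n) {x y : ℕ → ℂ} (hx : x 0 = 0)
    (h : ∀ n, y n = x n
      - ((w n / (n + 1) : ℝ) : ℂ) * ∑ k ∈ Finset.range (n + 1), x k / ((w k : ℝ) : ℂ)) :
    x = cesaroResolve w y := by
  have key : ∀ n : ℕ, ∑ k ∈ Finset.range (n + 1), x k / w k
      = (n + 1) * ∑ k ∈ Finset.range n, y (k + 1) / ((k + 1) * w (k + 1)) := by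
    intro n
    induction n with
    | zero => simp [hx]
    | succ n ih =>
      have h1 : (w (n + 1) : ℂ) ≠ 0 := by exact_mod_cast (hw (n + 1)).ne'
      have h2 : (n + 1 : ℂ) ≠ 0 := by exact_mod_cast n.succ_ne_zero
      have h3 : (n + 1 + 1 : ℂ) ≠ 0 := by exact_mod_cast (n + 1).succ_ne_zero
      have hn := h (n + 1)
      rw [Finset.sum_range_succ, ih] at hn
      rw [Finset.sum_range_succ, ih, Finset.sum_range_succ, hn]
      push_cast
      field_simp
      ring
  funext n
  have h2 : (n + 1 : ℂ) ≠ 0 := by exact_mod_cast n.succ_ne_zero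
  have hn := h n
  rw [key] at hn
  rw [cesaroResolve, hn]
  push_cast
  field_simp
  ring

lemma Uw_ne_top_iff {w : ℕ → ℝ} (hw : ∀ n, 0 < w n) :
    Uw w ≠ ⊤ ↔ ∃ C : ℝ, ∀ i N : ℕ,
      ∑ j ∈ Finset.range N, w (i + 1 + j) ≤ C * (((i : ℝ) + 1) * w (i + 1)) := by
  have hpos : ∀ i : ℕ, 0 < ((i : ℝ) + 1) * w (i + 1) := fun i => by
    have := hw (i + 1)
    positivity
  constructor
  · refine fun h => ⟨(Uw w).toReal, fun i N => ?_⟩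
    have h1 : ENNReal.ofReal (1 / (((i : ℝ) + 1) * w (i + 1)) *
        ∑ j ∈ Finset.range N, w (i + 1 + j)) ≤ Uw w := by
      rw [ENNReal.ofReal_mul (one_div_pos.2 (hpos i)).le,
        ENNReal.ofReal_sum_of_nonneg fun j _ => (hw _).le]
      refine le_trans ?_ (le_iSup _ i)
      gcongr
      exact ENNReal.sum_le_tsum _
    rw [ENNReal.ofReal_le_iff_le_toReal h, one_div, inv_mul_le_iff₀ (hpos i)] at h1
    linarith
  · rintro ⟨C, hC⟩
    refine ne_top_of_le_ne_top (ENNReal.ofReal_ne_top (r := C)) (iSup_le fun i => ?_)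
    rw [← ENNReal.tsum_mul_left]
    refine ENNReal.tsum_le_of_sum_range_le fun N => ?_
    rw [← Finset.mul_sum, ← ENNReal.ofReal_sum_of_nonneg fun j _ => (hw _).le,
      ← ENNReal.ofReal_mul (one_div_pos.2 (hpos i)).le]
    refine ENNReal.ofReal_le_ofReal ?_
    rw [one_div, inv_mul_le_iff₀ (hpos i)]
    linarith [hC i N]

lemma memlp_one_iff {f : ℕ → ℂ} : Memℓp f 1 ↔ Summable fun n => ‖f n‖ := by
  simp [memℓp_gen_iff (p := 1) (by simp)]

lemma sum_norm_le_norm (x : ellOne) (s : Finset ℕ) :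
    ∑ n ∈ s, ‖(x : ∀ _ : ℕ, ℂ) n‖ ≤ ‖x‖ := by
  simpa using lp.sum_rpow_le_norm_rpow (p := 1) (by simp) x s

lemma summable_mul_sum_range {w g : ℕ → ℝ} (hw : ∀ n, 0 < w n) (hg : ∀ n, 0 ≤ g n) {b : ℕ → ℝ}
    (hb : Summable b) (h : ∀ k N, g k * ∑ j ∈ Finset.range N, w (k + 1 + j) ≤ b k) :
    Summable fun n => w n * ∑ k ∈ Finset.range n, g k := by
  have hb0 : ∀ k, 0 ≤ b k := fun k => by simpa using h k 0
  refine summable_of_sum_range_le (c := ∑' k, b k)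
    (fun n => mul_nonneg (hw n).le (Finset.sum_nonneg fun k _ => hg k)) fun N => ?_
  calc ∑ n ∈ Finset.range N, w n * ∑ k ∈ Finset.range n, g k
      = ∑ k ∈ Finset.range N, ∑ n ∈ Finset.Ico (k + 1) N, w n * g k := by
        simp_rw [Finset.mul_sum]
        refine Finset.sum_comm' fun n k => ?_
        simp only [Finset.mem_range, Finset.mem_Ico]
        omega
    _ ≤ ∑ k ∈ Finset.range N, b k := by
        refine Finset.sum_le_sum fun k _ => ?_
        rw [← Finset.sum_mul, mul_comm, Finset.sum_Ico_eq_sum_range]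
        exact h k _
    _ ≤ ∑' k, b k := hb.sum_le_tsum _ fun k _ => hb0 k

lemma memlp_cesaroResolve {w : ℕ → ℝ} (hw : ∀ n, 0 < w n) (y : ellOne) {b : ℕ → ℝ}
    (hb : Summable b)
    (h : ∀ k N, ‖(y : ∀ _ : ℕ, ℂ) (k + 1)‖ / ((k + 1) * w (k + 1)) *
      ∑ j ∈ Finset.range N, w (k + 1 + j) ≤ b k) :
    Memℓp (cesaroResolve w y) 1 := by
  have hy := memlp_one_iff.1 (lp.memℓp y)
  rw [memlp_one_iff]
  have hs := summable_mul_sum_range hw (fun k => by have := hw (k + 1); positivity) hb h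
  refine Summable.of_nonneg_of_le (fun n => norm_nonneg _) (fun n => ?_) (hy.add hs)
  refine (norm_add_le _ _).trans ?_
  rw [norm_mul, Complex.norm_real, Real.norm_of_nonneg (hw n).le]
  gcongr
  · exact (hw n).le
  refine (norm_sum_le _ _).trans (Finset.sum_le_sum fun k _ => le_of_eq ?_)
  rw [norm_div, norm_mul, Complex.norm_real, Real.norm_of_nonneg (hw _).le]
  congr 2
  exact_mod_cast Complex.norm_natCast (k + 1)

lemma exists_sub_eq_of_memlp {w : ℕ → ℝ} (hw : ∀ n, 0 < w n) {T : ellOne →L[ℂ] ellOne}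
    (hT : IsCesaroOp w w T) {y : ellOne} (hy : (y : ∀ _ : ℕ, ℂ) 0 = 0)
    (hmem : Memℓp (cesaroResolve w y) 1) :
    ∃ x : ellOne, (x : ∀ _ : ℕ, ℂ) 0 = 0 ∧ x - T x = y := by
  refine ⟨⟨cesaroResolve w y, hmem⟩, by simp [cesaroResolve, hy], ?_⟩
  ext n
  have h2 : (n + 1 : ℂ) ≠ 0 := by exact_mod_cast n.succ_ne_zero
  rw [lp.coeFn_sub, Pi.sub_apply, hT]
  simp only
  rw [sum_cesaroResolve_div hw hy, cesaroResolve]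
  push_cast
  field_simp
  ring

lemma sub_apply_zero {w : ℕ → ℝ} (hw : ∀ n, 0 < w n) {T : ellOne →L[ℂ] ellOne}
    (hT : IsCesaroOp w w T) (x : ellOne) : ((x - T x : ellOne) : ∀ _ : ℕ, ℂ) 0 = 0 := by
  have h1 : (w 0 : ℂ) ≠ 0 := by exact_mod_cast (hw 0).ne'
  rw [lp.coeFn_sub, Pi.sub_apply, hT]
  simp [mul_div_cancel₀ _ h1]

lemma exists_sub_eq_single {w : ℕ → ℝ} (hw : ∀ n, 0 < w n) (hsum : Summable w)
    {T : ellOne →L[ℂ] ellOne} (hT : IsCesaroOp w w T) (i : ℕ) (a : ℂ) :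
    ∃ x : ellOne, x - T x = lp.single 1 (i + 1) a := by
  set y : ellOne := lp.single 1 (i + 1) a with hy
  have hy0 : (y : ∀ _ : ℕ, ℂ) 0 = 0 := lp.single_apply_ne _ _ _ (by omega)
  have hmem : Memℓp (cesaroResolve w y) 1 := by
    refine memlp_cesaroResolve hw y (b := fun k =>
      ‖(y : ∀ _ : ℕ, ℂ) (k + 1)‖ / ((k + 1) * w (k + 1)) * ∑' n, w n) ?_ fun k N => ?_
    · refine summable_of_ne_finset_zero (s := {i}) fun k hk => ?_
      have : (y : ∀ _ : ℕ, ℂ) (k + 1) = 0 :=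
        lp.single_apply_ne _ _ _ (by simpa using hk)
      simp [this]
    · have := hw (k + 1)
      gcongr
      have h := hsum.sum_le_tsum (Finset.Ico (k + 1) (k + 1 + N)) fun n _ => (hw n).le
      rwa [Finset.sum_Ico_eq_sum_range, Nat.add_sub_cancel_left] at h
  obtain ⟨x, -, hx⟩ := exists_sub_eq_of_memlp hw hT hy0 hmem
  exact ⟨x, hx⟩

/-- The subspace of `ℓ¹` of sequences with vanishing first coordinate. -/
def ellOneVanishing : Submodule ℂ ellOne :=
  LinearMap.ker (lp.evalCLM ℂ (fun _ : ℕ => ℂ) 1 0).toLinearMap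

lemma isClosed_ellOneVanishing : IsClosed {x : ellOne | (x : ∀ _ : ℕ, ℂ) 0 = 0} :=
  (lp.evalCLM ℂ (fun _ : ℕ => ℂ) 1 0).isClosed_ker

lemma weight_sub_eq_zero {w : ℕ → ℝ} (hw : ∀ n, 0 < w n) {T : ellOne →L[ℂ] ellOne}
    (hT : IsCesaroOp w w T) (z : ellOne) (hz : ∀ n, (z : ∀ _ : ℕ, ℂ) n = w n) :
    z - T z = 0 := by
  have hne : ∀ n, (w n : ℂ) ≠ 0 := fun n => by exact_mod_cast (hw n).ne'
  ext n
  have h2 : (n + 1 : ℂ) ≠ 0 := by exact_mod_cast n.succ_ne_zero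
  rw [lp.coeFn_sub, Pi.sub_apply, hT]
  simp [hz, hne, h2]

lemma exists_norm_le_of_image_eq {T : ellOne →L[ℂ] ellOne}
    (h : (fun x : ellOne => x - T x) '' {x : ellOne | (x : ∀ _ : ℕ, ℂ) 0 = 0}
         = {x : ellOne | (x : ∀ _ : ℕ, ℂ) 0 = 0}) :
    ∃ C : ℝ, ∀ y : ellOne, (y : ∀ _ : ℕ, ℂ) 0 = 0 →
      ∃ x : ellOne, (x : ∀ _ : ℕ, ℂ) 0 = 0 ∧ x - T x = y ∧ ‖x‖ ≤ C * ‖y‖ := by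
  have hcl : IsClosed (ellOneVanishing : Set ellOne) := isClosed_ellOneVanishing
  have : CompleteSpace ellOneVanishing := hcl.completeSpace_coe
  let f : ellOneVanishing →L[ℂ] ellOneVanishing :=
    ((ContinuousLinearMap.id ℂ ellOne - T).comp ellOneVanishing.subtypeL).codRestrict
      ellOneVanishing fun x => h.subset ⟨x, x.2, rfl⟩
  have hf : Function.Surjective f := by
    rintro ⟨y, hy⟩
    obtain ⟨x, hx, rfl⟩ := h.superset hy
    exact ⟨⟨x, hx⟩, rfl⟩
  obtain ⟨C, -, hC⟩ := f.exists_preimage_norm_le hf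
  refine ⟨C, fun y hy => ?_⟩
  obtain ⟨x, hx, hxC⟩ := hC ⟨y, hy⟩
  exact ⟨x, x.2, congrArg Subtype.val hx, hxC⟩

lemma Uw_ne_top_of_image_eq {w : ℕ → ℝ} (hw : ∀ n, 0 < w n) {T : ellOne →L[ℂ] ellOne}
    (hT : IsCesaroOp w w T)
    (h : (fun x : ellOne => x - T x) '' {x : ellOne | (x : ∀ _ : ℕ, ℂ) 0 = 0}
         = {x : ellOne | (x : ∀ _ : ℕ, ℂ) 0 = 0}) : Uw w ≠ ⊤ := by
  obtain ⟨C, hC⟩ := exists_norm_le_of_image_eq h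
  refine (Uw_ne_top_iff hw).2 ⟨C + 1, fun i N => ?_⟩
  have hpos : 0 < ((i : ℝ) + 1) * w (i + 1) := by
    have := hw (i + 1)
    positivity
  set y : ellOne := lp.single 1 (i + 1) (1 : ℂ) with hy
  have hy0 : (y : ∀ _ : ℕ, ℂ) 0 = 0 := lp.single_apply_ne _ _ _ (by omega)
  have hy1 : ‖y‖ = 1 := by simp [hy, lp.norm_single]
  obtain ⟨x, hx0, hxy, hx⟩ := hC y hy0
  have hxr : (x : ∀ _ : ℕ, ℂ) = cesaroResolve w y :=
    eq_cesaroResolve_of_sub hw hx0 fun n => by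
      rw [← hxy, lp.coeFn_sub, Pi.sub_apply, hT]
  have hterm : ∀ n ∈ Finset.Ico (i + 1) (i + 1 + N), w n / (((i : ℝ) + 1) * w (i + 1))
      ≤ ‖(x : ∀ _ : ℕ, ℂ) n‖ + ‖(y : ∀ _ : ℕ, ℂ) n‖ := by
    intro n hn
    rw [Finset.mem_Ico] at hn
    have hs : ∑ k ∈ Finset.range n, (y : ∀ _ : ℕ, ℂ) (k + 1) / ((k + 1) * w (k + 1))
        = 1 / ((i + 1) * w (i + 1)) := by
      rw [Finset.sum_eq_single i]
      · rw [hy, lp.single_apply_self]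
      · intro k _ hk
        rw [hy, lp.single_apply_ne _ _ _ (by omega), zero_div]
      · exact fun hi => absurd (Finset.mem_range.2 (by omega)) hi
    have hxn : ((w n / (((i : ℝ) + 1) * w (i + 1)) : ℝ) : ℂ)
        = (x : ∀ _ : ℕ, ℂ) n - (y : ∀ _ : ℕ, ℂ) n := by
      rw [hxr, cesaroResolve, hs]
      push_cast
      ring
    rw [← Real.norm_of_nonneg (div_pos (hw n) hpos).le, ← Complex.norm_real, hxn]
    exact norm_sub_le _ _
  have := Finset.sum_le_sum hterm
  rw [Finset.sum_add_distrib, ← Finset.sum_div, Finset.sum_Ico_eq_sum_range,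
    Nat.add_sub_cancel_left, div_le_iff₀ hpos] at this
  refine this.trans ?_
  gcongr
  · exact (sum_norm_le_norm x _).trans (by simpa [hy1] using hx)
  · exact (sum_norm_le_norm y _).trans hy1.le

theorem closed_range_tfae (w : ℕ → ℝ)
    (hw : ∀ n, 0 < w n) (hwb : ∃ C, ∀ n, w n ≤ C)
    (hsum : Summable w) (hM : Mvw w w ≠ ⊤)
    (T : ellOne →L[ℂ] ellOne) (hT : IsCesaroOp w w T) :
    List.TFAE
      [IsClosed (Set.range fun x : ellOne => x - T x),
       Set.range (fun x : ellOne => x - T x) = {x : ellOne | (x : ∀ _ : ℕ, ℂ) 0 = 0},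
       (fun x : ellOne => x - T x) '' {x : ellOne | (x : ∀ _ : ℕ, ℂ) 0 = 0}
         = {x : ellOne | (x : ∀ _ : ℕ, ℂ) 0 = 0},
       Uw w ≠ ⊤] := by
  have hsub : Set.range (fun x : ellOne => x - T x) ⊆ {x : ellOne | (x : ∀ _ : ℕ, ℂ) 0 = 0} := by
    rintro _ ⟨x, rfl⟩
    exact sub_apply_zero hw hT x
  tfae_have 1 → 2 := by
    intro h
    refine hsub.antisymm fun y hy => ?_
    refine h.mem_of_tendsto (lp.hasSum_single ENNReal.one_ne_top y) (Eventually.of_forall fun s => ?_)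
    refine (LinearMap.range (ContinuousLinearMap.id ℂ ellOne - T).toLinearMap).sum_mem fun i _ => ?_
    cases i with
    | zero =>
      rw [show (y : ∀ _ : ℕ, ℂ) 0 = 0 from hy, lp.single_zero]
      exact Submodule.zero_mem _
    | succ i => exact exists_sub_eq_single hw hsum hT i _
  tfae_have 2 → 1 := fun h => h ▸ isClosed_ellOneVanishing
  tfae_have 2 → 3 := by
    intro h
    refine ((Set.image_subset_range _ _).trans hsub).antisymm fun y hy => ?_
    obtain ⟨x, rfl⟩ := h.superset hy
    have hz : Memℓp (fun n => (w n : ℂ)) 1 :=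
      memlp_one_iff.2 (by simpa using hsum.abs)
    let z : ellOne := ⟨fun n => (w n : ℂ), hz⟩
    have hz0 : z - T z = 0 := weight_sub_eq_zero hw hT z fun n => rfl
    have h0 : (w 0 : ℂ) ≠ 0 := by exact_mod_cast (hw 0).ne'
    refine ⟨x - ((x : ∀ _ : ℕ, ℂ) 0 / w 0) • z, ?_, ?_⟩
    · change (x : ∀ _ : ℕ, ℂ) 0 - ((x : ∀ _ : ℕ, ℂ) 0 / w 0) * w 0 = 0
      rw [div_mul_cancel₀ _ h0, sub_self]
    · simp only [map_sub, map_smul]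
      rw [sub_sub_sub_comm, ← smul_sub, hz0, smul_zero, sub_zero]
  tfae_have 3 → 4 := Uw_ne_top_of_image_eq hw hT
  tfae_have 4 → 2 := by
    intro h
    obtain ⟨C, hC⟩ := (Uw_ne_top_iff hw).1 h
    refine hsub.antisymm fun y hy => ?_
    have hys := memlp_one_iff.1 (lp.memℓp y)
    have hmem := memlp_cesaroResolve hw y
      (((summable_nat_add_iff 1).2 hys).mul_right C) fun k N => by
        have := hw (k + 1)
        rw [div_mul_eq_mul_div, div_le_iff₀ (by positivity), mul_assoc]
        exact mul_le_mul_of_nonneg_left (hC k N) (norm_nonneg _)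
    obtain ⟨x, -, hx⟩ := exists_sub_eq_of_memlp hw hT hy hmem
    exact ⟨x, hx⟩
  tfae_finish
end
end

section
/- Let w be a weight with M_w < ∞ and let T : ℓ¹ → ℓ¹ be the continuous linear operator satisfying (T x)(n) = (w(n)/n) ∑_{k=1}^n x(k)/w(k) for all x ∈ ℓ¹ and n ≥ 1. If T is a compact operator, then necessarily 𝒰_w := sup_{m≥1} (1/(m·w(m+1))) ∑_{n=m+1}^∞ w(n) < ∞; in particular, T is power bounded and uniformly mean ergodic. -/
/- STATEMENT 19: If the transferred Cesàro operator T on ℓ¹ is compact then 𝒰_w < ∞; in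
particular T is power bounded and uniformly mean ergodic.
Index `n : ℕ` corresponds to the paper's `n+1`. -/

open Filter Topology

noncomputable section

section BanachAlgebra

theorem tendsto_pow_zero_of_spectralRadius_lt_one {A : Type*} [NormedRing A] [NormedAlgebra ℂ A]
    [CompleteSpace A] {a : A} (ha : spectralRadius ℂ a < 1) :
    Tendsto (fun n : ℕ => a ^ n) atTop (𝓝 0) := by
  obtain ⟨r, har, hr⟩ := ENNReal.lt_iff_exists_nnreal_btwn.1 ha
  have hev := (spectrum.gelfand_formula a).eventually (gt_mem_nhds har)
  have hr1 : (r : ℝ) < 1 := by exact_mod_cast hr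
  refine squeeze_zero_norm' (a := fun n : ℕ => (r : ℝ) ^ n) ?_
    (tendsto_pow_atTop_nhds_zero_of_lt_one r.2 hr1)
  filter_upwards [hev, eventually_ge_atTop 1] with n hn hn1
  have hpos : (0 : ℝ) < n := by exact_mod_cast hn1
  have h := ENNReal.rpow_le_rpow hn.le hpos.le
  rw [← ENNReal.rpow_mul, one_div, inv_mul_cancel₀ hpos.ne', ENNReal.rpow_one,
    ENNReal.rpow_natCast] at h
  exact_mod_cast h

theorem pow_succ_eq_add_sub_pow_succ {R : Type*} [Ring R] {t p : R} (hp : p * p = p)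
    (htp : t * p = p) (hpt : p * t = p) (m : ℕ) :
    t ^ (m + 1) = p + (t - p) ^ (m + 1) := by
  have h0 : p * (t - p) = 0 := by rw [mul_sub, hpt, hp, sub_self]
  induction m with
  | zero => simp
  | succ m ih =>
    have h1 : t * (t - p) ^ (m + 1) = (t - p) * (t - p) ^ (m + 1) := by
      rw [sub_mul t p, pow_succ' (t - p) m, ← mul_assoc p, h0, zero_mul, sub_zero]
    rw [pow_succ' t, ih, mul_add, htp, h1, ← pow_succ']

end BanachAlgebra

section Weights

variable {w : ℕ → ℝ}

theorem sum_range_le_of_tail_le (hw : ∀ n, 0 < w n)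
    (hs : Summable fun n : ℕ => w n / ((n : ℝ) + 1)) {N : ℕ}
    (hN : ∀ k ≥ N, ∑' j : ℕ, w (j + k) / (((j + k : ℕ) : ℝ) + 1) ≤ w k / 2) (K : ℕ) :
    ∀ k ≥ N, ∑ j ∈ Finset.range K, w (j + k) ≤
      2 * ((k : ℝ) + 1) * ∑' j : ℕ, w (j + k) / (((j + k : ℕ) : ℝ) + 1) := by
  have hnonneg : ∀ k : ℕ, 0 ≤ ∑' j : ℕ, w (j + k) / (((j + k : ℕ) : ℝ) + 1) := fun k =>
    tsum_nonneg fun j => div_nonneg (hw _).le (by positivity)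
  induction K with
  | zero =>
    intro k _
    have := hnonneg k
    simp only [Finset.range_zero, Finset.sum_empty]
    positivity
  | succ K ih =>
    intro k hk
    have hrec : ∑' j : ℕ, w (j + k) / (((j + k : ℕ) : ℝ) + 1) = w k / ((k : ℝ) + 1) +
        ∑' j : ℕ, w (j + (k + 1)) / (((j + (k + 1) : ℕ) : ℝ) + 1) := by
      have h := ((summable_nat_add_iff k).2 hs).tsum_eq_zero_add
      rw [h]
      simp only [zero_add, add_right_comm _ 1 k, add_assoc]
    have hsum : ∑ j ∈ Finset.range (K + 1), w (j + k) =
        w k + ∑ j ∈ Finset.range K, w (j + (k + 1)) := by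
      rw [Finset.sum_range_succ', add_comm]
      simp only [zero_add, add_right_comm _ 1 k, add_assoc]
    have hih := ih (k + 1) (by omega)
    have hk' := hN k hk
    rw [hrec] at hk' ⊢
    rw [hsum]
    have hpos : (0 : ℝ) < (k : ℝ) + 1 := by positivity
    have hdiv : ((k : ℝ) + 1) * (w k / ((k : ℝ) + 1)) = w k := by field_simp
    have hdiv0 : 0 ≤ w k / ((k : ℝ) + 1) := div_nonneg (hw k).le hpos.le
    push_cast at hih hk' ⊢
    linarith

theorem sum_range_le_of_tail_le_half (hw : ∀ n, 0 < w n)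
    (hs : Summable fun n : ℕ => w n / ((n : ℝ) + 1)) {N : ℕ}
    (hN : ∀ k ≥ N, ∑' j : ℕ, w (j + k) / (((j + k : ℕ) : ℝ) + 1) ≤ w k / 2) {k : ℕ} (hk : N ≤ k)
    (K : ℕ) : ∑ j ∈ Finset.range K, w (j + k) ≤ ((k : ℝ) + 1) * w k := by
  refine (sum_range_le_of_tail_le hw hs hN K k hk).trans ?_
  have hpos : (0 : ℝ) < (k : ℝ) + 1 := by positivity
  have := mul_le_mul_of_nonneg_left (hN k hk) (mul_nonneg zero_le_two hpos.le)
  linarith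

theorem summable_of_tail_le_half (hw : ∀ n, 0 < w n)
    (hs : Summable fun n : ℕ => w n / ((n : ℝ) + 1)) {N : ℕ}
    (hN : ∀ k ≥ N, ∑' j : ℕ, w (j + k) / (((j + k : ℕ) : ℝ) + 1) ≤ w k / 2) : Summable w :=
  (summable_nat_add_iff N).1 <| summable_of_sum_range_le (fun _ => (hw _).le)
    (sum_range_le_of_tail_le_half hw hs hN le_rfl)

theorem Uw_ne_top_of_tail_le_half (hw : ∀ n, 0 < w n)
    (hs : Summable fun n : ℕ => w n / ((n : ℝ) + 1)) {N : ℕ}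
    (hN : ∀ k ≥ N, ∑' j : ℕ, w (j + k) / (((j + k : ℕ) : ℝ) + 1) ≤ w k / 2) : Uw w ≠ ⊤ := by
  have hsum := summable_of_tail_le_half hw hs hN
  have hev : ∀ᶠ i : ℕ in atTop,
      1 / (((i : ℝ) + 1) * w (i + 1)) * ∑' k : ℕ, w (k + (i + 1)) ≤ 2 := by
    filter_upwards [eventually_ge_atTop N] with i hi
    have hle : ∑' k : ℕ, w (k + (i + 1)) ≤ (((i + 1 : ℕ) : ℝ) + 1) * w (i + 1) :=
      Real.tsum_le_of_sum_range_le (fun _ => (hw _).le)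
        (sum_range_le_of_tail_le_half hw hs hN (by omega))
    have hpos : 0 < ((i : ℝ) + 1) * w (i + 1) := mul_pos (by positivity) (hw _)
    rw [one_div, inv_mul_le_iff₀ hpos]
    have hi0 : (0 : ℝ) ≤ i := by positivity
    push_cast at hle
    nlinarith [hw (i + 1), mul_nonneg hi0 (hw (i + 1)).le]
  obtain ⟨B, hB⟩ := (isBoundedUnder_of_eventually_le hev).bddAbove_range
  refine ne_top_of_le_ne_top (b := ENNReal.ofReal B) ENNReal.ofReal_ne_top (iSup_le fun i => ?_)
  have hi := hB (Set.mem_range_self i)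
  have hpos : 0 < ((i : ℝ) + 1) * w (i + 1) := mul_pos (by positivity) (hw _)
  simp only [add_comm (i + 1)]
  rw [← ENNReal.ofReal_tsum_of_nonneg (fun _ => (hw _).le) ((summable_nat_add_iff (i + 1)).2 hsum),
    ← ENNReal.ofReal_mul (by positivity)]
  exact ENNReal.ofReal_le_ofReal hi

end Weights

section CesaroOperator

variable {v w : ℕ → ℝ} {T : ellOne →L[ℂ] ellOne}

theorem ellOne.hasSum_norm (x : ellOne) : HasSum (fun n => ‖(x : ∀ _ : ℕ, ℂ) n‖) ‖x‖ := by
  simpa using lp.hasSum_norm (p := 1) (by simp) x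

theorem ellOne.continuous_apply (n : ℕ) : Continuous fun x : ellOne => (x : ∀ _ : ℕ, ℂ) n :=
  (lp.evalCLM ℂ (fun _ : ℕ => ℂ) 1 n).continuous

theorem IsCesaroOp.apply_single (hT : IsCesaroOp v w T) (k n : ℕ) :
    (T (lp.single 1 k 1) : ∀ _ : ℕ, ℂ) n =
      if k ≤ n then ((w n / (n + 1) : ℝ) : ℂ) / ((v k : ℝ) : ℂ) else 0 := by
  rw [hT]
  simp only [lp.single_apply, Pi.single_apply, ite_div, zero_div, Finset.sum_ite_eq',
    Finset.mem_range, Nat.lt_succ_iff]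
  split_ifs <;> simp [div_eq_mul_inv]

theorem IsCesaroOp.tendsto_single (hT : IsCesaroOp v w T) (hcomp : IsCompactOperator T) :
    Tendsto (fun k : ℕ => T (lp.single 1 k 1)) atTop (𝓝 0) := by
  obtain ⟨K, hK, hsub⟩ := IsCompactOperator.image_closedBall_subset_compact
    (f := (T : ellOne →ₗ[ℂ] ellOne)) hcomp 1
  refine hK.tendsto_nhds_of_unique_mapClusterPt (Eventually.of_forall fun k => hsub ?_) ?_
  · refine Set.mem_image_of_mem _ ?_
    rw [mem_closedBall_zero_iff, lp.norm_single one_pos]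
    simp
  · intro y _ hy
    ext n
    have h := hy.continuousAt_comp (ellOne.continuous_apply n).continuousAt
    have hlim : Tendsto (fun k : ℕ => (T (lp.single 1 k 1) : ∀ _ : ℕ, ℂ) n) atTop (𝓝 0) := by
      refine tendsto_const_nhds.congr' ?_
      filter_upwards [eventually_gt_atTop n] with k hk
      rw [hT.apply_single, if_neg (by omega)]
    exact eq_of_nhds_neBot (ClusterPt.mono h hlim)

theorem IsCesaroOp.summable_div (hw : ∀ n, 0 < w n) (hT : IsCesaroOp w w T) :
    Summable fun n : ℕ => w n / ((n : ℝ) + 1) := by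
  have h := (ellOne.hasSum_norm (T (lp.single 1 0 1))).summable.mul_right (w 0)
  refine h.congr fun n => ?_
  have hn : 0 ≤ w n / ((n : ℝ) + 1) := div_nonneg (hw n).le (by positivity)
  rw [hT.apply_single, if_pos (Nat.zero_le n), norm_div, Complex.norm_of_nonneg hn,
    Complex.norm_of_nonneg (hw 0).le, div_mul_cancel₀ _ (hw 0).ne']

theorem IsCesaroOp.tail_le (hw : ∀ n, 0 < w n) (hT : IsCesaroOp w w T) (k : ℕ) :
    ∑' j : ℕ, w (j + k) / (((j + k : ℕ) : ℝ) + 1) ≤ ‖T (lp.single 1 k 1)‖ * w k := by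
  have h := ellOne.hasSum_norm (T (lp.single 1 k 1))
  have hle : ∑' j : ℕ, ‖(T (lp.single 1 k 1) : ∀ _ : ℕ, ℂ) (j + k)‖ ≤ ‖T (lp.single 1 k 1)‖ := by
    rw [← h.tsum_eq, ← h.summable.sum_add_tsum_nat_add k]
    exact le_add_of_nonneg_left (Finset.sum_nonneg fun _ _ => norm_nonneg _)
  refine le_trans (le_of_eq ?_) (mul_le_mul_of_nonneg_right hle (hw k).le)
  rw [← tsum_mul_right]
  refine tsum_congr fun j => ?_
  have hn : 0 ≤ w (j + k) / (((j + k : ℕ) : ℝ) + 1) := div_nonneg (hw _).le (by positivity)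
  rw [hT.apply_single, if_pos (Nat.le_add_left k j), norm_div, Complex.norm_of_nonneg hn,
    Complex.norm_of_nonneg (hw k).le, div_mul_cancel₀ _ (hw k).ne']

theorem IsCesaroOp.exists_tail_le_half (hw : ∀ n, 0 < w n) (hT : IsCesaroOp w w T)
    (hcomp : IsCompactOperator T) :
    ∃ N : ℕ, ∀ k ≥ N, ∑' j : ℕ, w (j + k) / (((j + k : ℕ) : ℝ) + 1) ≤ w k / 2 := by
  have hlim := (hT.tendsto_single hcomp).norm
  rw [norm_zero] at hlim
  obtain ⟨N, hN⟩ := eventually_atTop.1 (hlim.eventually (gt_mem_nhds (half_pos one_pos)))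
  refine ⟨N, fun k hk => (hT.tail_le hw k).trans ?_⟩
  have := mul_le_mul_of_nonneg_right (hN k hk).le (hw k).le
  linarith

theorem IsCesaroOp.apply_zero (hw : ∀ n, 0 < w n) (hT : IsCesaroOp w w T) (x : ellOne) :
    (T x : ∀ _ : ℕ, ℂ) 0 = (x : ∀ _ : ℕ, ℂ) 0 := by
  have h0 : (w 0 : ℂ) ≠ 0 := by exact_mod_cast (hw 0).ne'
  rw [hT]
  simp [mul_div_cancel₀ _ h0]

theorem IsCesaroOp.eq_zero_of_apply_eq_smul (hw : ∀ n, 0 < w n) (hT : IsCesaroOp w w T)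
    {x : ellOne} {z : ℂ} (hz : 1 ≤ ‖z‖) (hx0 : (x : ∀ _ : ℕ, ℂ) 0 = 0) (hx : T x = z • x) :
    x = 0 := by
  ext n
  rw [lp.coeFn_zero, Pi.zero_apply]
  induction n using Nat.strong_induction_on with
  | _ n ih =>
    rcases Nat.eq_zero_or_pos n with rfl | hn
    · exact hx0
    have hwn : (w n : ℂ) ≠ 0 := by exact_mod_cast (hw n).ne'
    have hn1 : (n : ℂ) + 1 ≠ 0 := by exact_mod_cast Nat.succ_ne_zero n
    have h := hT x n
    rw [hx, Finset.sum_range_succ, Finset.sum_eq_zero fun k hk => by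
      rw [ih k (Finset.mem_range.1 hk), zero_div], zero_add, lp.coeFn_smul, Pi.smul_apply,
      smul_eq_mul] at h
    by_contra hxn
    have hz' : z * ((n : ℂ) + 1) = 1 := by
      push_cast at h
      field_simp at h
      exact h
    have hnorm := congrArg norm hz'
    have hcast : ‖(n : ℂ) + 1‖ = (n : ℝ) + 1 := by
      exact_mod_cast Complex.norm_natCast (n + 1)
    rw [norm_mul, hcast, norm_one] at hnorm
    have hn' : (1 : ℝ) ≤ n := by exact_mod_cast hn
    nlinarith

theorem IsCesaroOp.exists_fixed (hw : ∀ n, 0 < w n) (hT : IsCesaroOp w w T) (hs : Summable w) :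
    ∃ u : ellOne, (u : ∀ _ : ℕ, ℂ) 0 = 1 ∧ T u = u := by
  have hmem : Memℓp (fun n : ℕ => (w n : ℂ) / (w 0 : ℂ)) 1 := by
    refine memℓp_gen ((hs.div_const (w 0)).congr fun n => ?_)
    rw [norm_div, Complex.norm_of_nonneg (hw n).le, Complex.norm_of_nonneg (hw 0).le]
    simp
  have h0 : ∀ n, (w n : ℂ) ≠ 0 := fun n => by exact_mod_cast (hw n).ne'
  refine ⟨⟨_, hmem⟩, div_self (h0 0), ?_⟩
  ext n
  rw [hT]
  have hn1 : (n : ℂ) + 1 ≠ 0 := by exact_mod_cast Nat.succ_ne_zero n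
  have hsum : ∑ k ∈ Finset.range (n + 1), (w k : ℂ) / (w 0 : ℂ) / (w k : ℂ) =
      ((n : ℂ) + 1) / (w 0 : ℂ) := by
    rw [Finset.sum_congr rfl fun k _ => by rw [div_right_comm, div_self (h0 k)]]
    simp [div_eq_mul_inv]
  change _ * ∑ k ∈ Finset.range (n + 1), (w k : ℂ) / (w 0 : ℂ) / (w k : ℂ) = _
  rw [hsum]
  have := h0 0
  push_cast
  field_simp

theorem IsCesaroOp.exists_tendsto_pow (hw : ∀ n, 0 < w n) (hT : IsCesaroOp w w T)
    (hcomp : IsCompactOperator T) (hs : Summable w) :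
    ∃ P : ellOne →L[ℂ] ellOne, Tendsto (fun m : ℕ => T ^ (m + 1)) atTop (𝓝 P) := by
  obtain ⟨u, hu0, hTu⟩ := hT.exists_fixed hw hs
  let P : ellOne →L[ℂ] ellOne := (lp.evalCLM ℂ (fun _ : ℕ => ℂ) 1 0).smulRight u
  have hP : ∀ x : ellOne, P x = (x : ∀ _ : ℕ, ℂ) 0 • u := fun x => rfl
  have hPP : P * P = P := by
    ext1 x
    simp [hP, hu0]
  have hTP : T * P = P := by
    ext1 x
    simp [hP, hTu]
  have hPT : P * T = P := by
    ext1 x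
    simp [hP, hT.apply_zero hw]
  have hScomp : IsCompactOperator (T - P) := by
    have h := hcomp.sub (hcomp.comp_clm P)
    have hcoe : ⇑(T - P) = ⇑T - ⇑T ∘ ⇑P := by
      conv_lhs => rw [← hTP]
      rfl
    rwa [hcoe]
  have hrad : spectralRadius ℂ (T - P) < 1 := by
    have hnt : Nontrivial ellOne := ⟨u, 0, fun h => by simp [h] at hu0⟩
    refine mod_cast spectrum.spectralRadius_lt_of_forall_lt (T - P) (r := 1) fun z hz => ?_
    by_contra hz1
    have hz1 : 1 ≤ ‖z‖ := not_lt.1 hz1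
    have hz0 : z ≠ 0 := norm_pos_iff.1 (one_pos.trans_le hz1)
    obtain ⟨x, hx⟩ := ((hScomp.hasEigenvalue_iff_mem_spectrum hz0).2 hz).exists_hasEigenvector
    have hxz : T x - (x : ∀ _ : ℕ, ℂ) 0 • u = z • x := hx.apply_eq_smul
    have hx0 : (x : ∀ _ : ℕ, ℂ) 0 = 0 := by
      have h := congrArg (fun y : ellOne => (y : ∀ _ : ℕ, ℂ) 0) hxz
      simpa only [lp.coeFn_sub, lp.coeFn_smul, Pi.sub_apply, Pi.smul_apply, smul_eq_mul,
        hT.apply_zero hw, hu0, mul_one, sub_self, zero_eq_mul, hz0, false_or] using h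
    rw [hx0, zero_smul, sub_zero] at hxz
    exact hx.2 (hT.eq_zero_of_apply_eq_smul hw hz1 hx0 hxz)
  refine ⟨P, ?_⟩
  simp only [pow_succ_eq_add_sub_pow_succ hPP hTP hPT]
  simpa using
    ((tendsto_add_atTop_iff_nat 1).2 (tendsto_pow_zero_of_spectralRadius_lt_one hrad)).const_add P

end CesaroOperator

theorem Uw_finite_of_compact (w : ℕ → ℝ)
    (hw : ∀ n, 0 < w n) (hwb : ∃ C, ∀ n, w n ≤ C)
    (hM : Mvw w w ≠ ⊤)
    (T : ellOne →L[ℂ] ellOne) (hT : IsCesaroOp w w T)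
    (hcomp : IsCompactOperator T) :
    Uw w ≠ ⊤ ∧
      (∃ C : ℝ, ∀ m : ℕ, 1 ≤ m → ‖T ^ m‖ ≤ C) ∧
      ∃ P : ellOne →L[ℂ] ellOne,
        Tendsto (fun n : ℕ => ((n : ℂ))⁻¹ • ∑ m ∈ Finset.Icc 1 n, T ^ m) atTop (nhds P) := by
  obtain ⟨N, hN⟩ := hT.exists_tail_le_half hw hcomp
  have hs := hT.summable_div hw
  obtain ⟨P, hP⟩ := hT.exists_tendsto_pow hw hcomp (summable_of_tail_le_half hw hs hN)
  refine ⟨Uw_ne_top_of_tail_le_half hw hs hN, ?_, P, ?_⟩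
  · obtain ⟨C, hC⟩ := hP.norm.bddAbove_range
    refine ⟨C, fun m hm => ?_⟩
    obtain ⟨m, rfl⟩ := Nat.exists_eq_add_of_le' hm
    exact hC (Set.mem_range_self m)
  · refine hP.cesaro_smul.congr fun n => ?_
    rw [inv_natCast_smul_eq ℝ ℂ, Finset.range_eq_Ico,
      Finset.sum_Ico_add' (fun m => T ^ m) 0 n 1, zero_add]
    rfl
end
end
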